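/- arXiv:1607.03503 — 3 statements merged into one kernel-verified Lean document; each statement's English description precedes it below -/
import Mathlib

section
/- Let Γ be an n-space group, let N be a normal subgroup of Γ, and let V = Span(N). If b + B ∈ Γ, then B V = V. -/
noncomputable section

/-- The translation `x ↦ a + x` of a normed additive group, as an isometry. -/
def transIso {X : Type*} [SeminormedAddCommGroup X] (a : X) : X ≃ᵢ X :=
  IsometryEquiv.constVAdd a

@[simp] lemma transIso_apply {X : Type*} [SeminormedAddCommGroup X] (a x : X) :
    transIso a x = a + x := rfl

/-- `parts φ a A` means that the isometry `φ` is `a + A`, i.e. `φ x = a + A x` for all `x`. -/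
def parts {X : Type*} [NormedAddCommGroup X] [InnerProductSpace ℝ X]
    (φ : X ≃ᵢ X) (a : X) (A : X ≃ₗᵢ[ℝ] X) : Prop :=
  ∀ x, φ x = a + A x

/-- The span of a group of isometries: the real span of the set of translation vectors of
the translations belonging to the group. -/
def spanOf {X : Type*} [NormedAddCommGroup X] [InnerProductSpace ℝ X]
    (H : Subgroup (X ≃ᵢ X)) : Submodule ℝ X :=
  Submodule.span ℝ {a : X | transIso a ∈ H}

/-- A space group: a group of isometries acting discontinuously (the discreteness condition)
with compact quotient (expressed by a compact set meeting every orbit). -/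
def IsSpaceGroup {X : Type*} [MetricSpace X] (Γ : Subgroup (X ≃ᵢ X)) : Prop :=
  (∀ K : Set X, IsCompact K →
    {γ : X ≃ᵢ X | γ ∈ Γ ∧ ((γ : X → X) '' K ∩ K).Nonempty}.Finite) ∧
  ∃ K : Set X, IsCompact K ∧ ∀ x : X, ∃ γ ∈ Γ, (γ : X → X) x ∈ K

/-- `N` is a complete normal subgroup of `Γ`: it is normal in `Γ` and consists exactly of
those `a + A ∈ Γ` with `a ∈ Span N` and `A` fixing `(Span N)ᗮ` pointwise. -/
def IsCompleteNormal {X : Type*} [NormedAddCommGroup X] [InnerProductSpace ℝ X]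
    (Γ N : Subgroup (X ≃ᵢ X)) : Prop :=
  N ≤ Γ ∧ (∀ γ ∈ Γ, ∀ ν ∈ N, γ * ν * γ⁻¹ ∈ N) ∧
  ∀ φ ∈ Γ, ∀ (a : X) (A : X ≃ₗᵢ[ℝ] X), parts φ a A →
    (φ ∈ N ↔ a ∈ spanOf N ∧ ∀ w ∈ (spanOf N)ᗮ, A w = w)

/-- The real span of the set of translation vectors of the central translations of `N`,
i.e. `Span(Z(N))`. -/
def centerSpan {X : Type*} [NormedAddCommGroup X] [InnerProductSpace ℝ X]
    (N : Subgroup (X ≃ᵢ X)) : Submodule ℝ X :=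
  Submodule.span ℝ
    {u : X | ∃ h : transIso u ∈ N, (⟨transIso u, h⟩ : N) ∈ Subgroup.center N}


/-- Conjugating a translation by an isometry `b + B` applies `B` to its translation vector. -/
lemma parts.conj_transIso {X : Type*} [NormedAddCommGroup X] [InnerProductSpace ℝ X]
    {φ : X ≃ᵢ X} {b : X} {B : X ≃ₗᵢ[ℝ] X} (h : parts φ b B) (a : X) :
    φ * transIso a * φ⁻¹ = transIso (B a) := by
  rw [mul_inv_eq_iff_eq_mul]
  ext1 x
  simp only [IsometryEquiv.mul_apply, transIso_apply, h _, map_add]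
  abel

/-- **Theorem 1(1)**: if `N` is a normal subgroup of an `n`-space group `Γ`, `V = Span N`,
and `b + B ∈ Γ`, then `B V = V`. -/
theorem spanOf_map_eq_of_normal {n : ℕ}
    (Γ N : Subgroup (EuclideanSpace ℝ (Fin n) ≃ᵢ EuclideanSpace ℝ (Fin n)))
    (hΓ : IsSpaceGroup Γ) (hNΓ : N ≤ Γ)
    (hNnormal : ∀ γ ∈ Γ, ∀ ν ∈ N, γ * ν * γ⁻¹ ∈ N)
    (φ : EuclideanSpace ℝ (Fin n) ≃ᵢ EuclideanSpace ℝ (Fin n)) (hφ : φ ∈ Γ)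
    (b : EuclideanSpace ℝ (Fin n))
    (B : EuclideanSpace ℝ (Fin n) ≃ₗᵢ[ℝ] EuclideanSpace ℝ (Fin n))
    (hparts : parts φ b B) :
    Submodule.map (B.toLinearEquiv.toLinearMap) (spanOf N) = spanOf N := by
  rw [spanOf, Submodule.map_span]
  congr 1
  ext v
  constructor
  · rintro ⟨a, ha, rfl⟩
    have hmem := hNnormal φ hφ _ ha
    rwa [hparts.conj_transIso] at hmem
  · intro hv
    refine ⟨B.symm v, ?_, B.apply_symm_apply v⟩
    have hmem := hNnormal φ⁻¹ (inv_mem hφ) _ hv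
    rw [← B.apply_symm_apply v, ← hparts.conj_transIso] at hmem
    simpa [mul_assoc] using hmem
end
end

section
/- Let Γ be an n-space group, let N be a normal subgroup of Γ, and let V = Span(N). If a + A ∈ N, then a ∈ V and A fixes every vector of the orthogonal complement V^⊥ of V in Eⁿ. -/
noncomputable section

section BieberbachTranslations

open Filter Topology

variable {E : Type*} [NormedAddCommGroup E] [InnerProductSpace ℝ E]

/-- The linear part of an isometry, as a continuous linear map. -/
def linPart (φ : E ≃ᵢ E) : E →L[ℝ] E :=
  (φ.toRealLinearIsometryEquiv : E →L[ℝ] E)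

lemma linPart_apply (φ : E ≃ᵢ E) (x : E) : linPart φ x = φ x - φ 0 :=
  φ.toRealLinearIsometryEquiv_apply x

lemma apply_eq_add_linPart (φ : E ≃ᵢ E) (x : E) : φ x = φ 0 + linPart φ x := by
  rw [linPart_apply]; abel

lemma norm_linPart_apply (φ : E ≃ᵢ E) (x : E) : ‖linPart φ x‖ = ‖x‖ :=
  φ.toRealLinearIsometryEquiv.norm_map x

lemma norm_linPart_le_one (φ : E ≃ᵢ E) : ‖linPart φ‖ ≤ 1 :=
  ContinuousLinearMap.opNorm_le_bound _ zero_le_one fun x => by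
    rw [norm_linPart_apply, one_mul]

lemma linPart_mul (φ ψ : E ≃ᵢ E) : linPart (φ * ψ) = linPart φ * linPart ψ := by
  ext x
  rw [mul_apply_eq_comp, linPart_apply ψ, map_sub]
  simp only [linPart_apply, IsometryEquiv.mul_apply]
  abel

lemma linPart_one : linPart (1 : E ≃ᵢ E) = 1 := by
  ext x
  simp [linPart_apply]

lemma linPart_inv_mul_self (φ : E ≃ᵢ E) : linPart φ⁻¹ * linPart φ = 1 := by
  rw [← linPart_mul, inv_mul_cancel, linPart_one]

lemma linPart_mul_inv_self (φ : E ≃ᵢ E) : linPart φ * linPart φ⁻¹ = 1 := by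
  rw [← linPart_mul, mul_inv_cancel, linPart_one]

lemma eq_transIso_of_linPart_eq_one {φ : E ≃ᵢ E} (h : linPart φ = 1) : φ = transIso (φ 0) := by
  ext1 x
  rw [apply_eq_add_linPart, h]
  rfl

lemma norm_linPart_mul_inv_sub_one_le (φ ψ : E ≃ᵢ E) :
    ‖linPart (φ * ψ⁻¹) - 1‖ ≤ ‖linPart φ - linPart ψ‖ := by
  have h : linPart (φ * ψ⁻¹) - 1 = (linPart φ - linPart ψ) * linPart ψ⁻¹ := by
    rw [sub_mul, linPart_mul_inv_self, linPart_mul]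
  rw [h]
  exact (norm_mul_le _ _).trans
    (mul_le_of_le_one_right (norm_nonneg _) (norm_linPart_le_one _))

lemma norm_linPart_commutator_sub_one_le (φ ψ : E ≃ᵢ E) :
    ‖linPart (φ * ψ * φ⁻¹ * ψ⁻¹) - 1‖ ≤ 2 * ‖linPart φ - 1‖ * ‖linPart ψ - 1‖ := by
  have h : φ * ψ * φ⁻¹ * ψ⁻¹ = (φ * ψ) * (ψ * φ)⁻¹ := by group
  have h' : linPart (φ * ψ) - linPart (ψ * φ) =
      (linPart φ - 1) * (linPart ψ - 1) - (linPart ψ - 1) * (linPart φ - 1) := by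
    rw [linPart_mul, linPart_mul]; noncomm_ring
  rw [h]
  refine (norm_linPart_mul_inv_sub_one_le _ _).trans ?_
  rw [h']
  refine (norm_sub_le _ _).trans ?_
  have h1 := norm_mul_le (linPart φ - 1) (linPart ψ - 1)
  have h2 := norm_mul_le (linPart ψ - 1) (linPart φ - 1)
  linarith

/-- Up to an error controlled by the linear part of `ψ`, the commutator of `φ` and `ψ` moves the
origin by `(A - 1) b`, where `A` is the linear part of `φ` and `b = ψ 0`. -/
lemma norm_commutator_apply_zero_sub_le (φ ψ : E ≃ᵢ E) :
    ‖(φ * ψ * φ⁻¹ * ψ⁻¹) 0 - (linPart φ - 1) (ψ 0)‖ ≤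
      ‖linPart (φ * ψ * φ⁻¹ * ψ⁻¹) - 1‖ * ‖ψ 0‖ + ‖linPart ψ - 1‖ * ‖φ 0‖ := by
  set χ := φ * ψ * φ⁻¹ * ψ⁻¹ with hχ
  have h1 : χ (ψ (φ 0)) = φ (ψ 0) := by simp [hχ]
  have h2 : linPart χ * linPart ψ = linPart φ * linPart ψ * linPart φ⁻¹ := by
    rw [← linPart_mul, ← linPart_mul, ← linPart_mul, hχ, inv_mul_cancel_right]
  have h3 : χ 0 - (linPart φ - 1) (ψ 0) =
      -(linPart χ - 1) (ψ 0) - (linPart φ * (linPart ψ - 1) * linPart φ⁻¹) (φ 0) := by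
    have h4 : linPart φ * (linPart ψ - 1) * linPart φ⁻¹ = linPart χ * linPart ψ - 1 := by
      rw [h2, mul_sub, sub_mul, mul_one, linPart_mul_inv_self]
    rw [h4]
    rw [apply_eq_add_linPart χ, apply_eq_add_linPart φ (ψ 0), apply_eq_add_linPart ψ (φ 0),
      map_add] at h1
    simp only [sub_apply, one_apply_eq_self,
      mul_apply_eq_comp]
    linear_combination (norm := module) h1
  rw [h3]
  refine (norm_sub_le _ _).trans (add_le_add ?_ ?_)
  · rw [norm_neg]
    exact ContinuousLinearMap.le_opNorm _ _
  · rw [mul_apply_eq_comp, mul_apply_eq_comp, norm_linPart_apply]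
    refine (ContinuousLinearMap.le_opNorm _ _).trans ?_
    rw [norm_linPart_apply]

/-- If `A` is orthogonal and `C = A - 1`, then `x ↦ C x` strictly improves the ratio `‖C x‖ / ‖x‖`
on a suitable nonempty cone `c * ‖x‖ ≤ ‖C x‖`. -/
lemma exists_cone_linPart_sub_one [FiniteDimensional ℝ E] (φ : E ≃ᵢ E) (hφ : linPart φ ≠ 1) :
    ∃ c, 0 < c ∧ c < ‖linPart φ - 1‖ ∧ ∃ η, 0 < η ∧ ∀ x : E,
      c * ‖x‖ ≤ ‖(linPart φ - 1) x‖ →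
      c * ‖(linPart φ - 1) x‖ + η * ‖x‖ ≤ ‖(linPart φ - 1) ((linPart φ - 1) x)‖ := by
  set C := linPart φ - 1 with hC
  have hC0 : 0 < ‖C‖ := norm_pos_iff.2 (sub_ne_zero.2 hφ)
  let S : E →L[ℝ] E := -(linPart φ⁻¹ * (C * C))
  have hS : ∀ x, ‖S x‖ = ‖C (C x)‖ := fun x => by
    simp [S, norm_linPart_apply]
  have hadj : ∀ x y : E, inner ℝ x (linPart φ y) = inner ℝ (linPart φ⁻¹ x) y := fun x y => by
    have h : linPart φ (linPart φ⁻¹ x) = x := by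
      rw [← mul_apply_eq_comp, linPart_mul_inv_self]; rfl
    conv_lhs => rw [← h]
    exact φ.toRealLinearIsometryEquiv.inner_map_map _ _
  have hinner : ∀ x, inner ℝ (S x) x = ‖C x‖ ^ 2 := fun x => by
    have h : S x = linPart φ⁻¹ (C x) - C x := by
      have : -(linPart φ⁻¹ * (C * C)) = linPart φ⁻¹ * C - C := by
        have h0 := linPart_inv_mul_self φ
        have h1 : C * C = linPart φ * C - C := by rw [hC]; noncomm_ring
        rw [h1, mul_sub, ← mul_assoc, h0, one_mul]; abel
      change (-(linPart φ⁻¹ * (C * C))) x = _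
      rw [this]; rfl
    rw [h, inner_sub_left, ← hadj, ← inner_sub_right, ← real_inner_self_eq_norm_sq]
    rfl
  have hfin : {c : ℝ | c ∈ Set.Ioo 0 ‖C‖ ∧
      Module.End.HasEigenvalue (S : E →ₗ[ℝ] E) (c ^ 2)}.Finite := by
    have hinj : Set.InjOn (fun c : ℝ => c ^ 2) (Set.Ioo 0 ‖C‖) := fun x hx y hy h =>
      (pow_left_inj₀ hx.1.le hy.1.le two_ne_zero).1 h
    refine Set.Finite.of_finite_image ?_ (hinj.mono fun c hc => hc.1)
    exact (Module.End.finite_hasEigenvalue (S : E →ₗ[ℝ] E)).subset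
      (Set.image_subset_iff.2 fun c hc => hc.2)
  obtain ⟨c, hc, hcS⟩ := ((Set.Ioo_infinite hC0).sdiff hfin).nonempty
  have hcS : ¬ Module.End.HasEigenvalue (S : E →ₗ[ℝ] E) (c ^ 2) := fun h => hcS ⟨hc, h⟩
  have hpos : ∀ x, ‖x‖ = 1 → c ≤ ‖C x‖ → 0 < ‖C (C x)‖ - c * ‖C x‖ := by
    intro x hx hcx
    by_contra! hle
    have h1 : ‖C x‖ ^ 2 ≤ ‖C (C x)‖ := by
      have := real_inner_le_norm (S x) x
      rwa [hinner, hS, hx, mul_one] at this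
    have h2 : ‖C x‖ = c := by nlinarith [hc.1]
    have h3 : ‖C (C x)‖ = c ^ 2 := by rw [h2] at h1 hle; nlinarith
    have h4 : inner ℝ (S x) x = ‖S x‖ * ‖x‖ := by rw [hinner, hS, hx, h2, h3, mul_one]
    rw [inner_eq_norm_mul_iff_real, hx, one_smul, hS, h3] at h4
    refine hcS (Module.End.hasEigenvalue_of_hasEigenvector (x := x)
      (Module.End.hasEigenvector_iff.2 ⟨Module.End.mem_eigenspace_iff.2 h4, ?_⟩))
    rintro rfl
    simp at hx
  have hη : ∃ η, 0 < η ∧ ∀ x, ‖x‖ = 1 → c ≤ ‖C x‖ → η ≤ ‖C (C x)‖ - c * ‖C x‖ := by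
    have hK : IsCompact (Metric.sphere (0 : E) 1 ∩ {x | c ≤ ‖C x‖}) :=
      (isCompact_sphere 0 1).inter_right (isClosed_le continuous_const (by fun_prop))
    rcases (Metric.sphere (0 : E) 1 ∩ {x | c ≤ ‖C x‖}).eq_empty_or_nonempty with he | hne
    · refine ⟨1, one_pos, fun x hx hcx => ?_⟩
      have : x ∈ Metric.sphere (0 : E) 1 ∩ {x | c ≤ ‖C x‖} := ⟨by simpa using hx, hcx⟩
      simp [he] at this
    · obtain ⟨y, hy, hmin⟩ := hK.exists_isMinOn hne
        (f := fun x => ‖C (C x)‖ - c * ‖C x‖) (by fun_prop)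
      exact ⟨_, hpos y (by simpa using hy.1) hy.2, fun x hx hcx =>
        hmin (show x ∈ _ from ⟨by simpa using hx, hcx⟩)⟩
  obtain ⟨η, hη0, hη⟩ := hη
  refine ⟨c, hc.1, hc.2, η, hη0, fun x hx => ?_⟩
  rcases eq_or_ne x 0 with rfl | hx0
  · simp
  have hn : 0 < ‖x‖ := norm_pos_iff.2 hx0
  have key := hη (‖x‖⁻¹ • x) (by rw [norm_smul, norm_inv, norm_norm, inv_mul_cancel₀ hn.ne'])
  simp only [map_smul, norm_smul, norm_inv, norm_norm] at key
  have h1 := key (by rwa [inv_mul_eq_div, le_div_iff₀ hn])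
  have h2 : ‖x‖⁻¹ * ‖C (C x)‖ - c * (‖x‖⁻¹ * ‖C x‖) = (‖C (C x)‖ - c * ‖C x‖) / ‖x‖ := by
    field_simp
  rw [h2, le_div_iff₀ hn] at h1
  linarith

/-- Any sequence of isometries has two members, the later one beyond any prescribed bound,
whose linear parts are close. -/
lemma exists_frequently_linPart_close [FiniteDimensional ℝ E] (β : ℕ → E ≃ᵢ E)
    {ε : ℝ} (hε : 0 < ε) :
    ∃ i, ∀ m, ∃ j ≥ m, ‖linPart (β j) - linPart (β i)‖ < ε := by
  obtain ⟨A, -, f, hf, hlim⟩ := tendsto_subseq_of_bounded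
    (Metric.isBounded_closedBall (x := (0 : E →L[ℝ] E)) (r := 1)) (x := fun k => linPart (β k))
    (fun k => by simpa using norm_linPart_le_one (β k))
  obtain ⟨k, hk⟩ := Metric.cauchySeq_iff'.1 hlim.cauchySeq ε hε
  refine ⟨f k, fun m => ⟨f (max k m), (le_max_right k m).trans (hf.id_le _), ?_⟩⟩
  simpa [dist_eq_norm] using hk (max k m) (le_max_left k m)

/-- A space group contains elements whose linear part is nearly the identity and that move the
origin nearly in any prescribed direction. -/
lemma IsSpaceGroup.exists_linPart_close_direction [FiniteDimensional ℝ E] {Γ : Subgroup (E ≃ᵢ E)}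
    (hΓ : IsSpaceGroup Γ) {U : Set E} (hU : IsOpen U) {u : E} (hu : u ∈ U)
    {ε : ℝ} (hε : 0 < ε) :
    ∃ β ∈ Γ, ‖linPart β - 1‖ < ε ∧ ∃ t : ℝ, 0 < t ∧ t • β 0 ∈ U := by
  obtain ⟨K, hK, hcov⟩ := hΓ.2
  obtain ⟨R, hR⟩ := hK.isBounded.exists_norm_le
  have hβ : ∀ k : ℕ, ∃ β ∈ Γ, ‖β 0 - (k : ℝ) • u‖ ≤ R := fun k => by
    obtain ⟨γ, hγ, hγK⟩ := hcov ((k : ℝ) • u)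
    refine ⟨γ⁻¹, Γ.inv_mem hγ, ?_⟩
    rw [← dist_eq_norm, ← γ.dist_eq, IsometryEquiv.apply_inv_self, dist_zero_left]
    exact hR _ hγK
  choose β hβΓ hβR using hβ
  obtain ⟨δ, hδ, hball⟩ := Metric.isOpen_iff.1 hU u hu
  obtain ⟨i, hi⟩ := exists_frequently_linPart_close β hε
  obtain ⟨m, hm⟩ := exists_nat_gt ((R + ‖β i 0‖) / δ)
  obtain ⟨j, hj, hji⟩ := hi (m + 1)
  have hmj : (m : ℝ) + 1 ≤ j := by exact_mod_cast hj
  have hj0 : (0 : ℝ) < j := lt_of_lt_of_le (by positivity) hmj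
  refine ⟨β j * (β i)⁻¹, Γ.mul_mem (hβΓ j) (Γ.inv_mem (hβΓ i)),
    (norm_linPart_mul_inv_sub_one_le _ _).trans_lt hji, (j : ℝ)⁻¹, inv_pos.2 hj0, hball ?_⟩
  have hdist : ‖(β j * (β i)⁻¹) 0 - (j : ℝ) • u‖ ≤ R + ‖β i 0‖ := by
    have h1 : ‖(β j * (β i)⁻¹) 0 - β j 0‖ = ‖β i 0‖ := by
      rw [← dist_eq_norm, IsometryEquiv.mul_apply, (β j).dist_eq, ← (β i).dist_eq,
        IsometryEquiv.apply_inv_self, dist_zero_left]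
    have := norm_sub_le_norm_sub_add_norm_sub ((β j * (β i)⁻¹) 0) (β j 0) ((j : ℝ) • u)
    linarith [hβR j]
  rw [div_lt_iff₀ hδ] at hm
  have h2 : (j : ℝ)⁻¹ • (β j * (β i)⁻¹) 0 - u =
      (j : ℝ)⁻¹ • ((β j * (β i)⁻¹) 0 - (j : ℝ) • u) := by
    rw [smul_sub, inv_smul_smul₀ hj0.ne']
  rw [mem_ball_iff_norm, h2, norm_smul, norm_inv, Real.norm_of_nonneg hj0.le, inv_mul_lt_iff₀ hj0]
  nlinarith

/-- In a space group, any nonempty set of elements has one moving the origin the least. -/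
lemma IsSpaceGroup.exists_min_norm_apply_zero [FiniteDimensional ℝ E] {Γ : Subgroup (E ≃ᵢ E)}
    (hΓ : IsSpaceGroup Γ) {S : Set (E ≃ᵢ E)} (hS : S ⊆ Γ) (hne : S.Nonempty) :
    ∃ α ∈ S, ∀ β ∈ S, ‖α 0‖ ≤ ‖β 0‖ := by
  obtain ⟨σ, hσ⟩ := hne
  have hfin : {γ | γ ∈ S ∧ ‖γ 0‖ ≤ ‖σ 0‖}.Finite := by
    refine (hΓ.1 _ (isCompact_closedBall (0 : E) ‖σ 0‖)).subset fun γ hγ =>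
      ⟨hS hγ.1, γ 0, ⟨0, by simp, rfl⟩, by simpa using hγ.2⟩
  obtain ⟨α, hα, hmin⟩ := Set.exists_min_image _ (fun γ : E ≃ᵢ E => ‖γ 0‖) hfin ⟨σ, hσ, le_rfl⟩
  refine ⟨α, hα.1, fun β hβ => ?_⟩
  rcases le_total ‖β 0‖ ‖σ 0‖ with h | h
  · exact hmin β ⟨hβ, h⟩
  · exact hα.2.trans h

/-- An element of a space group whose linear part is close to the identity is a translation. -/
lemma IsSpaceGroup.linPart_eq_one [FiniteDimensional ℝ E] {Γ : Subgroup (E ≃ᵢ E)}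
    (hΓ : IsSpaceGroup Γ) {γ : E ≃ᵢ E} (hγ : γ ∈ Γ) (hγ1 : ‖linPart γ - 1‖ ≤ 1 / 2) :
    linPart γ = 1 := by
  by_contra hne
  obtain ⟨α, ⟨hαΓ, hα1, hαne⟩, hαmin⟩ := hΓ.exists_min_norm_apply_zero
    (S := {γ | γ ∈ Γ ∧ ‖linPart γ - 1‖ ≤ 1 / 2 ∧ linPart γ ≠ 1}) (fun _ h => h.1)
    ⟨γ, hγ, hγ1, hne⟩
  obtain ⟨c, hc0, hcC, η, hη0, hη⟩ := exists_cone_linPart_sub_one α hαne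
  set C := linPart α - 1 with hC
  obtain ⟨ε, hε0, hε⟩ : ∃ ε, 0 < ε ∧ ε ≤ min (1 / 8) (min (c / 4) (η / 4)) :=
    ⟨_, by positivity, le_rfl⟩
  simp only [le_min_iff] at hε
  obtain ⟨u, hu⟩ : ∃ u, c * ‖u‖ < ‖C u‖ := by
    by_contra! h
    exact hcC.not_ge (ContinuousLinearMap.opNorm_le_bound _ hc0.le h)
  obtain ⟨β₀, hβ₀Γ, hβ₀ε, t, ht, htU⟩ := hΓ.exists_linPart_close_direction
    (U := {x | c * ‖x‖ < ‖C x‖}) (isOpen_lt (by fun_prop) (by fun_prop)) hu hε0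
  have hβ₀ : c * ‖β₀ 0‖ < ‖C (β₀ 0)‖ := by
    rw [Set.mem_ofPred_eq, map_smul, norm_smul, norm_smul, mul_left_comm] at htU
    exact lt_of_mul_lt_mul_left htU (norm_nonneg _)
  obtain ⟨β, ⟨hβΓ, hβε, hβ0, hβc⟩, hβmin⟩ := hΓ.exists_min_norm_apply_zero
    (S := {β | β ∈ Γ ∧ ‖linPart β - 1‖ ≤ ε ∧ β 0 ≠ 0 ∧ c * ‖β 0‖ ≤ ‖C (β 0)‖}) (fun _ h => h.1)
    ⟨β₀, hβ₀Γ, hβ₀ε.le, fun h => by simp [h] at hβ₀, hβ₀.le⟩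
  set b := β 0 with hb
  have hbpos : 0 < ‖b‖ := norm_pos_iff.2 hβ0
  set χ := α * β * α⁻¹ * β⁻¹ with hχ
  have hχΓ : χ ∈ Γ := Γ.mul_mem (Γ.mul_mem (Γ.mul_mem hαΓ hβΓ) (Γ.inv_mem hαΓ)) (Γ.inv_mem hβΓ)
  have hχβ : ‖linPart χ - 1‖ ≤ ‖linPart β - 1‖ :=
    (norm_linPart_commutator_sub_one_le α β).trans
      (mul_le_of_le_one_left (norm_nonneg _) (by linarith))
  have hβα : ‖linPart β - 1‖ * ‖α 0‖ ≤ ε * ‖b‖ := by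
    by_cases h : linPart β = 1
    · rw [h, sub_self, norm_zero, zero_mul]
      positivity
    · exact mul_le_mul hβε (hαmin β ⟨hβΓ, by linarith, h⟩) (norm_nonneg _) hε0.le
  have hr : ‖χ 0 - C b‖ ≤ 2 * ε * ‖b‖ := by
    have h1 := norm_commutator_apply_zero_sub_le α β
    have h2 : ‖linPart χ - 1‖ * ‖b‖ ≤ ε * ‖b‖ :=
      mul_le_mul_of_nonneg_right (hχβ.trans hβε) hbpos.le
    linarith
  have hCle : ∀ x, ‖C x‖ ≤ 1 / 2 * ‖x‖ := fun x =>
    (C.le_opNorm x).trans (mul_le_mul_of_nonneg_right hα1 (norm_nonneg _))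
  have hup : ‖χ 0‖ ≤ ‖C b‖ + 2 * ε * ‖b‖ := by
    have := norm_le_norm_add_norm_sub' (χ 0) (C b)
    linarith
  have hlow : ‖C b‖ - 2 * ε * ‖b‖ ≤ ‖χ 0‖ := by
    have := norm_le_norm_add_norm_sub (χ 0) (C b)
    linarith
  have hlt : ‖χ 0‖ < ‖b‖ := by nlinarith [hCle b]
  have hχ0 : χ 0 ≠ 0 := norm_pos_iff.1 (by nlinarith)
  have hcone : c * ‖χ 0‖ ≤ ‖C (χ 0)‖ := by
    have h1 : ‖C (C b)‖ ≤ ‖C (χ 0)‖ + ‖C (χ 0 - C b)‖ := by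
      rw [map_sub]
      exact norm_le_norm_add_norm_sub _ _
    have h2 := hCle (χ 0 - C b)
    have h3 := hη b hβc
    have h4 : c * ‖χ 0‖ ≤ c * ‖C b‖ + 1 / 2 * (2 * ε * ‖b‖) := by
      have h5 : c * (2 * ε * ‖b‖) ≤ 1 / 2 * (2 * ε * ‖b‖) :=
        mul_le_mul_of_nonneg_right (by linarith) (by positivity)
      have := mul_le_mul_of_nonneg_left hup hc0.le
      linarith
    nlinarith
  exact hlt.not_ge (hβmin χ ⟨hχΓ, hχβ.trans hβε, hχ0, hcone⟩)

/-- The translations of a space group span the whole space. -/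
lemma IsSpaceGroup.spanOf_eq_top [FiniteDimensional ℝ E] {Γ : Subgroup (E ≃ᵢ E)}
    (hΓ : IsSpaceGroup Γ) : spanOf Γ = ⊤ := by
  by_contra hne
  obtain ⟨u, -, hu⟩ := SetLike.exists_of_lt (lt_top_iff_ne_top.2 hne)
  obtain ⟨β, hβ, hβ1, t, -, htU⟩ := hΓ.exists_linPart_close_direction
    (U := (spanOf Γ : Set E)ᶜ) (spanOf Γ).closed_of_finiteDimensional.isOpen_compl hu one_half_pos
  refine htU ((spanOf Γ).smul_mem t (Submodule.subset_span ?_))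
  rw [Set.mem_ofPred_eq, ← eq_transIso_of_linPart_eq_one (hΓ.linPart_eq_one hβ hβ1.le)]
  exact hβ

/-- Some positive power of an element of a space group is a translation. -/
lemma IsSpaceGroup.exists_pow_eq_transIso [FiniteDimensional ℝ E] {Γ : Subgroup (E ≃ᵢ E)}
    (hΓ : IsSpaceGroup Γ) {γ : E ≃ᵢ E} (hγ : γ ∈ Γ) :
    ∃ k : ℕ, k ≠ 0 ∧ γ ^ k = transIso ((γ ^ k) 0) := by
  obtain ⟨i, hi⟩ := exists_frequently_linPart_close (fun k => γ ^ k) one_half_pos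
  obtain ⟨j, hj, hji⟩ := hi (i + 1)
  refine ⟨j - i, by omega, eq_transIso_of_linPart_eq_one
    (hΓ.linPart_eq_one (Γ.pow_mem hγ _) ?_)⟩
  rw [pow_sub γ (by omega)]
  exact (norm_linPart_mul_inv_sub_one_le _ _).trans hji.le

end BieberbachTranslations

/-- **Theorem 1(2)**: if `N` is a normal subgroup of an `n`-space group `Γ`, `V = Span N`,
and `a + A ∈ N`, then `a ∈ V` and `A` fixes every vector of `Vᗮ`. -/
theorem mem_span_and_fixes_orthogonal_of_mem_normal {n : ℕ}
    (Γ N : Subgroup (EuclideanSpace ℝ (Fin n) ≃ᵢ EuclideanSpace ℝ (Fin n)))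
    (hΓ : IsSpaceGroup Γ) (hNΓ : N ≤ Γ)
    (hNnormal : ∀ γ ∈ Γ, ∀ ν ∈ N, γ * ν * γ⁻¹ ∈ N)
    (ν : EuclideanSpace ℝ (Fin n) ≃ᵢ EuclideanSpace ℝ (Fin n)) (hν : ν ∈ N)
    (a : EuclideanSpace ℝ (Fin n))
    (A : EuclideanSpace ℝ (Fin n) ≃ₗᵢ[ℝ] EuclideanSpace ℝ (Fin n))
    (hparts : parts ν a A) :
    a ∈ spanOf N ∧ ∀ w ∈ (spanOf N)ᗮ, A w = w := by
  have hmove : ∀ x, x - A x ∈ spanOf N := by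
    intro x
    have hx : x ∈ spanOf Γ := hΓ.spanOf_eq_top ▸ Submodule.mem_top
    induction hx using Submodule.span_induction with
    | mem b hb =>
      refine Submodule.subset_span ?_
      have hcomm : transIso (b - A b) = transIso b * ν * (transIso b)⁻¹ * ν⁻¹ := by
        rw [eq_mul_inv_iff_mul_eq, eq_mul_inv_iff_mul_eq]
        ext1 y
        simp only [IsometryEquiv.mul_apply, transIso_apply, hparts _, map_add]
        abel
      rw [Set.mem_ofPred_eq, hcomm]
      exact N.mul_mem (hNnormal _ hb ν hν) (N.inv_mem hν)
    | zero => simp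
    | add x y _ _ hx hy =>
      rw [map_add, add_sub_add_comm]
      exact add_mem hx hy
    | smul r x _ hx =>
      rw [map_smul, ← smul_sub]
      exact Submodule.smul_mem _ r hx
  refine ⟨?_, fun w hw => ?_⟩
  · have hpow : ∀ k : ℕ, (ν ^ k) 0 - (k : ℝ) • a ∈ spanOf N := by
      intro k
      induction k with
      | zero => simp
      | succ k ih =>
        have h : (ν ^ (k + 1)) 0 - ((k + 1 : ℕ) : ℝ) • a =
            ((ν ^ k) 0 - (k : ℝ) • a) - ((ν ^ k) 0 - A ((ν ^ k) 0)) := by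
          rw [pow_succ', IsometryEquiv.mul_apply, hparts, Nat.cast_succ, add_smul, one_smul]
          abel
        rw [h]
        exact sub_mem ih (hmove _)
    obtain ⟨k, hk, hkν⟩ := hΓ.exists_pow_eq_transIso (hNΓ hν)
    have h1 : (ν ^ k) 0 ∈ spanOf N := by
      refine Submodule.subset_span ?_
      rw [Set.mem_ofPred_eq, ← hkν]
      exact N.pow_mem hν k
    have h2 : (k : ℝ) • a ∈ spanOf N := by
      simpa using sub_mem h1 (hpow k)
    exact ((spanOf N).smul_mem_iff (Nat.cast_ne_zero.2 hk)).1 h2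
  · have h := Submodule.inner_right_of_mem_orthogonal (hmove w) hw
    rw [inner_sub_left, real_inner_self_eq_norm_sq, real_inner_comm] at h
    have h2 := norm_sub_sq_real w (A w)
    rw [A.norm_map] at h2
    have h3 : ‖w - A w‖ ^ 2 = 0 := by linarith
    exact (sub_eq_zero.1 (norm_eq_zero.1 (pow_eq_zero_iff two_ne_zero |>.1 h3))).symm
end
end

section
/- Let N be a complete normal subgroup of an n-space group Γ, let T be the group of translations of Γ, and let 𝒞 = Span(Z(N)) regarded as a (Γ/N)-module via N(b+B)·v = B̄v. Let f : Γ/N → 𝒞 be a crossed homomorphism. Then: (i) the restriction f_res of f to TN/N is a homomorphism of (Γ/N)-modules, i.e. f_res is additive and f_res((Nγ)x(Nγ)⁻¹) = (Nγ)·f_res(x) for all γ ∈ Γ and x ∈ TN/N; and (ii) if f, h : Γ/N → 𝒞 are crossed homomorphisms with the same restriction to TN/N, then f − h is a principal crossed homomorphism; thus the class of f in H¹(Γ/N, 𝒞) is completely determined by f_res. -/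
noncomputable section

/-- The set of elements of `TN`: products of a translation of `Γ` and an element of `N`. -/
def TNset {X : Type*} [NormedAddCommGroup X] [InnerProductSpace ℝ X]
    (Γ N : Subgroup (X ≃ᵢ X)) : Set (X ≃ᵢ X) :=
  {g | ∃ (a : X) (ν : X ≃ᵢ X), transIso a ∈ Γ ∧ ν ∈ N ∧ g = transIso a * ν}

section LinearPart

variable {X : Type*} [NormedAddCommGroup X] [InnerProductSpace ℝ X]

/-- The rotational part of an isometry, as a group homomorphism. -/
def linearPart : (X ≃ᵢ X) →* (X ≃ₗᵢ[ℝ] X) where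
  toFun φ := φ.toRealLinearIsometryEquiv
  map_one' := by ext x; simp
  map_mul' φ ψ := by
    ext x
    have h := φ.toRealLinearIsometryEquiv.map_sub (ψ x) (ψ 0)
    simp only [IsometryEquiv.toRealLinearIsometryEquiv_apply] at h
    simp [h]

lemma linearPart_apply (φ : X ≃ᵢ X) (x : X) : linearPart φ x = φ x - φ 0 :=
  φ.toRealLinearIsometryEquiv_apply x

lemma apply_eq_add_linearPart (φ : X ≃ᵢ X) (x : X) : φ x = φ 0 + linearPart φ x := by
  simp [linearPart_apply]

lemma parts_linearPart (φ : X ≃ᵢ X) : parts φ (φ 0) (linearPart φ) :=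
  apply_eq_add_linearPart φ

lemma parts.linearPart_eq {φ : X ≃ᵢ X} {a : X} {A : X ≃ₗᵢ[ℝ] X} (h : parts φ a A) :
    linearPart φ = A := by
  ext x
  simp [linearPart_apply, h x, h 0]

@[simp] lemma linearPart_transIso (a : X) : linearPart (transIso a) = 1 := by
  ext x
  simp [linearPart_apply]

lemma eq_transIso_of_linearPart_eq_one {φ : X ≃ᵢ X} (h : linearPart φ = 1) :
    φ = transIso (φ 0) := by
  ext x
  simp [apply_eq_add_linearPart φ x, h]

/-- Elements of `N` act trivially on the span of the center of `N`. -/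
lemma linearPart_apply_of_mem_centerSpan {N : Subgroup (X ≃ᵢ X)} {ν : X ≃ᵢ X} (hν : ν ∈ N)
    {v : X} (hv : v ∈ centerSpan N) : linearPart ν v = v := by
  induction hv using Submodule.span_induction with
  | mem u hu =>
    obtain ⟨hu, hc⟩ := hu
    have h := congrArg Subtype.val (Subgroup.mem_center_iff.1 hc ⟨ν, hν⟩)
    have h0 := DFunLike.congr_fun h 0
    simp only [Subgroup.coe_mul, IsometryEquiv.mul_apply, transIso_apply, add_zero] at h0
    rw [linearPart_apply, h0, add_sub_cancel_right]
  | zero => simp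
  | add x y _ _ hx hy => rw [map_add, hx, hy]
  | smul c x _ hx => rw [map_smul, hx]

end LinearPart

section Displacement

variable {X : Type*} [NormedAddCommGroup X] [InnerProductSpace ℝ X]

/-- The displacement operator `A - I` of a linear isometry `A`. -/
def displacement (A : X ≃ₗᵢ[ℝ] X) : X →L[ℝ] X :=
  (A.toContinuousLinearEquiv : X →L[ℝ] X) - 1

@[simp] lemma displacement_apply (A : X ≃ₗᵢ[ℝ] X) (x : X) : displacement A x = A x - x := rfl

lemma norm_sub_le_displacement (A : X ≃ₗᵢ[ℝ] X) (x : X) :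
    ‖A x - x‖ ≤ ‖displacement A‖ * ‖x‖ :=
  (displacement A).le_opNorm x

lemma norm_displacement_pos {A : X ≃ₗᵢ[ℝ] X} (hA : A ≠ 1) : 0 < ‖displacement A‖ := by
  refine norm_pos_iff.2 fun h => hA ?_
  ext x
  exact sub_eq_zero.1 (DFunLike.congr_fun h x)

lemma norm_displacement_mul_inv (A B : X ≃ₗᵢ[ℝ] X) :
    ‖displacement (A * B⁻¹)‖ ≤ ‖(A.toContinuousLinearEquiv : X →L[ℝ] X) -
      (B.toContinuousLinearEquiv : X →L[ℝ] X)‖ := by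
  refine ContinuousLinearMap.opNorm_le_bound _ (norm_nonneg _) fun x => ?_
  have h := ((A.toContinuousLinearEquiv : X →L[ℝ] X) -
    (B.toContinuousLinearEquiv : X →L[ℝ] X)).le_opNorm (B⁻¹ x)
  simpa using h

lemma norm_displacement_commutator (A B : X ≃ₗᵢ[ℝ] X) :
    ‖displacement (A * B * A⁻¹ * B⁻¹)‖ ≤ 2 * ‖displacement A‖ * ‖displacement B‖ := by
  refine ContinuousLinearMap.opNorm_le_bound _ (by positivity) fun x => ?_
  obtain ⟨y, rfl⟩ : ∃ y, x = B (A y) := ⟨A.symm (B.symm x), by simp⟩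
  have h₁ : displacement (A * B * A⁻¹ * B⁻¹) (B (A y)) =
      displacement A (displacement B y) - displacement B (displacement A y) := by
    simp; abel
  have hA := (displacement A).le_opNorm
  have hB := (displacement B).le_opNorm
  rw [h₁, LinearIsometryEquiv.norm_map, LinearIsometryEquiv.norm_map]
  calc _ ≤ ‖displacement A (displacement B y)‖ + ‖displacement B (displacement A y)‖ :=
        norm_sub_le _ _
    _ ≤ ‖displacement A‖ * (‖displacement B‖ * ‖y‖) +
        ‖displacement B‖ * (‖displacement A‖ * ‖y‖) := by
        gcongr
        · exact (hA _).trans (by gcongr; exact hB y)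
        · exact (hB _).trans (by gcongr; exact hA y)
    _ = _ := by ring

variable [FiniteDimensional ℝ X]

/-- Among infinitely many linear isometries, infinitely many are close to a fixed one. -/
lemma exists_displacement_mul_inv_le (A : ℕ → X ≃ₗᵢ[ℝ] X) {ε : ℝ} (hε : 0 < ε) :
    ∃ i, ∀ M, ∃ j, M < j ∧ ‖displacement (A j * (A i)⁻¹)‖ ≤ ε := by
  let F : ℕ → X →L[ℝ] X := fun k => ((A k).toContinuousLinearEquiv : X →L[ℝ] X)
  have hF (k : ℕ) : F k ∈ Metric.closedBall (0 : X →L[ℝ] X) 1 := by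
    rw [mem_closedBall_zero_iff]
    refine ContinuousLinearMap.opNorm_le_bound _ zero_le_one fun x => ?_
    simp [F]
  have : ProperSpace (X →L[ℝ] X) := FiniteDimensional.proper ℝ _
  obtain ⟨_, _, φ, hφ, hlim⟩ := tendsto_subseq_of_bounded Metric.isBounded_closedBall hF
  obtain ⟨k, hk⟩ := Metric.cauchySeq_iff.1 hlim.cauchySeq ε hε
  refine ⟨φ k, fun M => ⟨φ (max k (M + 1)), ?_, ?_⟩⟩
  · have := hφ.id_le (max k (M + 1))
    have : M + 1 ≤ max k (M + 1) := le_max_right _ _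
    simp only [id] at *
    omega
  · refine (norm_displacement_mul_inv _ _).trans ?_
    have := hk _ (le_max_left k (M + 1)) k le_rfl
    rw [dist_eq_norm] at this
    exact this.le

end Displacement

section Gap

variable {X : Type*} [NormedAddCommGroup X] [InnerProductSpace ℝ X] [FiniteDimensional ℝ X]

lemma exists_norm_apply_eq_opNorm {V W : Type*} [NormedAddCommGroup V] [NormedSpace ℝ V]
    [FiniteDimensional ℝ V] [Nontrivial V] [NormedAddCommGroup W] [NormedSpace ℝ W]
    (L : V →L[ℝ] W) : ∃ x : V, ‖x‖ = 1 ∧ ‖L x‖ = ‖L‖ := by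
  have : ProperSpace V := FiniteDimensional.proper ℝ V
  obtain ⟨x, hx, hmax⟩ := (isCompact_sphere (0 : V) 1).exists_isMaxOn
    (NormedSpace.sphere_nonempty.2 zero_le_one) (f := fun x => ‖L x‖) (by fun_prop)
  rw [mem_sphere_zero_iff_norm] at hx
  refine ⟨x, hx, le_antisymm (by simpa [hx] using L.le_opNorm x) ?_⟩
  refine L.opNorm_le_of_unit_norm (norm_nonneg _) fun y hy => ?_
  exact hmax (mem_sphere_zero_iff_norm.2 hy)

/-- The subspace on which a continuous linear map attains its operator norm. -/
def normingSubspace (L : X →L[ℝ] X) : Submodule ℝ X :=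
  LinearMap.ker ((L.adjoint ∘L L - (‖L‖ ^ 2) • ContinuousLinearMap.id ℝ X : X →L[ℝ] X) :
    X →ₗ[ℝ] X)

lemma mem_normingSubspace {L : X →L[ℝ] X} {x : X} :
    x ∈ normingSubspace L ↔ ‖L x‖ = ‖L‖ * ‖x‖ := by
  have key : x ∈ normingSubspace L ↔ L.adjoint (L x) = ‖L‖ ^ 2 • x := by
    simp [normingSubspace, sub_eq_zero]
  have hin : inner ℝ (L.adjoint (L x)) x = ‖L x‖ ^ 2 := by
    rw [ContinuousLinearMap.adjoint_inner_left, real_inner_self_eq_norm_sq]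
  rw [key]
  constructor
  · intro h
    rw [h, real_inner_smul_left, real_inner_self_eq_norm_sq, ← mul_pow] at hin
    exact ((pow_left_inj₀ (by positivity) (by positivity) two_ne_zero).1 hin).symm
  · intro h
    have h₁ : ‖L.adjoint (L x)‖ ≤ ‖L‖ ^ 2 * ‖x‖ := by
      refine (L.adjoint.le_opNorm _).trans (le_of_eq ?_)
      rw [LinearIsometryEquiv.norm_map, h]
      ring
    have h₂ : ‖L.adjoint (L x) - ‖L‖ ^ 2 • x‖ ^ 2 ≤ 0 := by
      rw [norm_sub_sq_real, real_inner_smul_right, hin, h, norm_smul, norm_pow, norm_norm]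
      have := pow_le_pow_left₀ (norm_nonneg _) h₁ 2
      nlinarith
    exact sub_eq_zero.1 (norm_eq_zero.1 (pow_eq_zero_iff two_ne_zero |>.1
      (le_antisymm h₂ (sq_nonneg _))))

/-- A continuous linear map is bounded away from its norm on the orthogonal complement of its
norming subspace. -/
lemma exists_lt_norm_forall_orthogonal (L : X →L[ℝ] X) (hL : 0 < ‖L‖) :
    ∃ c, 0 ≤ c ∧ c < ‖L‖ ∧ ∀ x ∈ (normingSubspace L)ᗮ, ‖L x‖ ≤ c * ‖x‖ := by
  let K := L ∘L (normingSubspace L)ᗮ.subtypeL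
  refine ⟨‖K‖, K.opNorm_nonneg, ?_, fun x hx => K.le_opNorm ⟨x, hx⟩⟩
  rcases subsingleton_or_nontrivial ((normingSubspace L)ᗮ : Submodule ℝ X) with h | h
  · rwa [Subsingleton.elim K 0, ContinuousLinearMap.opNorm_zero]
  obtain ⟨x, hx, hKx⟩ := exists_norm_apply_eq_opNorm K
  have hx' : ‖(x : X)‖ = 1 := hx
  have hLx : ‖L x‖ = ‖K‖ := hKx
  have hle := L.le_opNorm x
  rw [hx', mul_one, hLx] at hle
  refine lt_of_le_of_ne hle fun heq => ?_
  have hmem : (x : X) ∈ normingSubspace L := by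
    rw [mem_normingSubspace, hLx, heq, hx', mul_one]
  have := inner_self_eq_zero (𝕜 := ℝ).1 ((Submodule.mem_orthogonal _ _).1 x.2 _ hmem)
  simp [this] at hx'

lemma normingSubspace_ne_bot [Nontrivial X] (L : X →L[ℝ] X) : normingSubspace L ≠ ⊥ := by
  obtain ⟨x, hx, hLx⟩ := exists_norm_apply_eq_opNorm L
  refine (Submodule.ne_bot_iff _).2 ⟨x, mem_normingSubspace.2 (by rw [hLx, hx, mul_one]), ?_⟩
  rintro rfl
  simp at hx

variable (A : X ≃ₗᵢ[ℝ] X)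

lemma map_mem_normingSubspace_displacement {x : X}
    (hx : x ∈ normingSubspace (displacement A)) : A x ∈ normingSubspace (displacement A) := by
  rw [mem_normingSubspace] at *
  rw [A.norm_map, ← hx, displacement_apply, displacement_apply, ← map_sub, A.norm_map]

lemma symm_map_mem_normingSubspace_displacement {x : X}
    (hx : x ∈ normingSubspace (displacement A)) :
    A.symm x ∈ normingSubspace (displacement A) := by
  rw [mem_normingSubspace] at *
  rw [A.symm.norm_map, ← hx, displacement_apply, displacement_apply, A.apply_symm_apply,
    ← A.norm_map, map_sub, A.apply_symm_apply]

lemma starProjection_displacement (x : X) :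
    (normingSubspace (displacement A)).starProjection (displacement A x) =
      displacement A ((normingSubspace (displacement A)).starProjection x) := by
  set E := normingSubspace (displacement A)
  have hP : E.starProjection x ∈ E := E.starProjection_apply_mem x
  symm
  refine (E.eq_starProjection_of_mem_orthogonal ?_ ?_).symm
  · exact E.sub_mem (map_mem_normingSubspace_displacement A hP) hP
  · rw [← map_sub]
    have hQ := E.sub_starProjection_mem_orthogonal x
    refine Eᗮ.sub_mem ((Submodule.mem_orthogonal _ _).2 fun u hu => ?_) hQ
    have hAA : A.symm (A (x - E.starProjection x)) = x - E.starProjection x :=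
      A.symm_apply_apply _
    refine (A.symm.inner_map_map _ _).symm.trans ?_
    refine (congrArg (inner ℝ _) hAA).trans ?_
    exact (Submodule.mem_orthogonal _ _).1 hQ _
      (symm_map_mem_normingSubspace_displacement A hu)

end Gap

section Bieberbach

lemma IsSpaceGroup.exists_norm_sub_le {X : Type*} [NormedAddCommGroup X]
    {Γ : Subgroup (X ≃ᵢ X)} (hΓ : IsSpaceGroup Γ) :
    ∃ R : ℝ, ∀ x : X, ∃ γ ∈ Γ, ‖γ 0 - x‖ ≤ R := by
  obtain ⟨K, hK, hcov⟩ := hΓ.2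
  obtain ⟨R, hR⟩ := hK.isBounded.exists_norm_le
  refine ⟨R, fun x => ?_⟩
  obtain ⟨γ, hγ, hx⟩ := hcov x
  refine ⟨γ⁻¹, Γ.inv_mem hγ, ?_⟩
  rw [← dist_eq_norm, ← γ.dist_eq, IsometryEquiv.apply_inv_self, dist_zero_left]
  exact hR _ hx

variable {X : Type*} [NormedAddCommGroup X] [InnerProductSpace ℝ X]

lemma commutator_apply_zero (α β : X ≃ᵢ X) :
    (α * β * α⁻¹ * β⁻¹) 0 = displacement (linearPart α) (β 0) -
      displacement (linearPart (α * β * α⁻¹ * β⁻¹)) (β 0) -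
      linearPart α (displacement (linearPart β) ((linearPart α)⁻¹ (α 0))) := by
  have h : (α * β * α⁻¹ * β⁻¹) (β (α 0)) = α (β 0) := by simp
  rw [apply_eq_add_linearPart _ (β (α 0)), apply_eq_add_linearPart β (α 0),
    apply_eq_add_linearPart α (β 0)] at h
  rw [eq_sub_of_add_eq h]
  simp
  abel

variable [FiniteDimensional ℝ X] {Γ : Subgroup (X ≃ᵢ X)}

namespace IsSpaceGroup

lemma finite_norm_apply_zero_le (hΓ : IsSpaceGroup Γ) (R : ℝ) :
    {γ : X ≃ᵢ X | γ ∈ Γ ∧ ‖γ 0‖ ≤ R}.Finite := by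
  have : ProperSpace X := FiniteDimensional.proper ℝ X
  refine (hΓ.1 (Metric.closedBall 0 R) (isCompact_closedBall 0 R)).subset ?_
  rintro γ ⟨hγ, hR⟩
  have hR0 : 0 ≤ R := (norm_nonneg _).trans hR
  exact ⟨hγ, γ 0, ⟨0, by simpa using hR0, rfl⟩, by simpa using hR⟩

/-- A nonempty set of elements of a space group has an element of least translation length. -/
lemma exists_min_norm (hΓ : IsSpaceGroup Γ) {p : (X ≃ᵢ X) → Prop}
    (hp : ∃ γ ∈ Γ, p γ) : ∃ γ ∈ Γ, p γ ∧ ∀ δ ∈ Γ, p δ → ‖γ 0‖ ≤ ‖δ 0‖ := by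
  obtain ⟨γ₀, hγ₀, hpγ₀⟩ := hp
  have hfin : {γ : X ≃ᵢ X | (γ ∈ Γ ∧ ‖γ 0‖ ≤ ‖γ₀ 0‖) ∧ p γ}.Finite :=
    (hΓ.finite_norm_apply_zero_le ‖γ₀ 0‖).subset fun γ h => h.1
  obtain ⟨γ, ⟨⟨hγ, hle⟩, hpγ⟩, hmin⟩ := hfin.exists_minimalFor (fun γ => ‖γ 0‖) _
    ⟨γ₀, ⟨hγ₀, le_rfl⟩, hpγ₀⟩
  refine ⟨γ, hγ, hpγ, fun δ hδ hpδ => ?_⟩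
  rcases le_total ‖δ 0‖ ‖γ 0‖ with h | h
  · exact hmin ⟨⟨hδ, h.trans hle⟩, hpδ⟩ h
  · exact h

/-- A space group has elements with almost trivial rotational part whose translation part
points approximately into a prescribed nonzero subspace. -/
lemma exists_displacement_le (hΓ : IsSpaceGroup Γ) {E : Submodule ℝ X} (hE : E ≠ ⊥)
    {ε : ℝ} (hε : 0 < ε) :
    ∃ β ∈ Γ, ‖displacement (linearPart β)‖ ≤ ε ∧
      ‖β 0 - E.starProjection (β 0)‖ < ‖E.starProjection (β 0)‖ := by
  obtain ⟨R, hR⟩ := hΓ.exists_norm_sub_le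
  obtain ⟨w, hwE, hw⟩ := (Submodule.ne_bot_iff _).1 hE
  obtain ⟨u, huE, hu⟩ : ∃ u ∈ E, ‖u‖ = 1 :=
    ⟨‖w‖⁻¹ • w, E.smul_mem _ hwE, by rw [norm_smul, norm_inv, norm_norm,
      inv_mul_cancel₀ (norm_ne_zero_iff.2 hw)]⟩
  choose g hg hgR using fun k : ℕ => hR ((k : ℝ) • u)
  obtain ⟨i, hi⟩ := exists_displacement_mul_inv_le (fun k => linearPart (g k)) hε
  set C := R + ‖g i 0‖
  obtain ⟨M, hM⟩ := exists_nat_gt (2 * C)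
  obtain ⟨j, hj, hjε⟩ := hi M
  refine ⟨g j * (g i)⁻¹, Γ.mul_mem (hg j) (Γ.inv_mem (hg i)), by simpa using hjε, ?_⟩
  set b := (g j * (g i)⁻¹) 0
  have hb : ‖b - (j : ℝ) • u‖ ≤ C := by
    have h₁ : ‖b - g j 0‖ = ‖g i 0‖ := by
      have h : b = g j ((g i)⁻¹ 0) := rfl
      rw [h, ← dist_eq_norm, (g j).dist_eq, ← (g i).dist_eq, IsometryEquiv.apply_inv_self,
        dist_zero_left]
    calc ‖b - (j : ℝ) • u‖ = ‖(g j 0 - (j : ℝ) • u) + (b - g j 0)‖ := by congr 1; abel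
      _ ≤ ‖g j 0 - (j : ℝ) • u‖ + ‖b - g j 0‖ := norm_add_le _ _
      _ ≤ C := by rw [h₁]; exact add_le_add_left (hgR j) _
  have hju : E.starProjection ((j : ℝ) • u) = (j : ℝ) • u :=
    Submodule.starProjection_eq_self_iff.2 (E.smul_mem _ huE)
  have hperp : ‖b - E.starProjection b‖ ≤ C := by
    have h : b - E.starProjection b = Eᗮ.starProjection (b - (j : ℝ) • u) := by
      rw [E.starProjection_orthogonal_val, map_sub, hju]
      abel
    rw [h]
    exact (Submodule.norm_starProjection_apply_le _ _).trans hb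
  have hpar : (j : ℝ) - C ≤ ‖E.starProjection b‖ := by
    have h₁ : ‖E.starProjection (b - (j : ℝ) • u)‖ ≤ C :=
      (E.norm_starProjection_apply_le _).trans hb
    rw [map_sub, hju] at h₁
    have h₂ : ‖(j : ℝ) • u‖ = j := by simp [norm_smul, hu]
    have h₃ := norm_sub_norm_le ((j : ℝ) • u) (E.starProjection b)
    rw [norm_sub_rev, h₂] at h₃
    linarith
  have : (M : ℝ) < j := by exact_mod_cast hj
  linarith

/-- An element of a space group whose rotational part is close to the identity is a
translation. -/
theorem linearPart_eq_one (hΓ : IsSpaceGroup Γ) {γ : X ≃ᵢ X} (hγ : γ ∈ Γ)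
    (h : ‖displacement (linearPart γ)‖ ≤ 1 / 2) : linearPart γ = 1 := by
  by_contra hne
  obtain ⟨α, hα, ⟨hα₁, hαle⟩, hαmin⟩ := hΓ.exists_min_norm
    (p := fun γ => linearPart γ ≠ 1 ∧ ‖displacement (linearPart γ)‖ ≤ 1 / 2)
    ⟨γ, hγ, hne, h⟩
  set A := linearPart α with hA
  set m := ‖displacement A‖ with hm
  have hm0 : 0 < m := norm_displacement_pos hα₁
  have : Nontrivial X := by
    by_contra hX
    rw [not_nontrivial_iff_subsingleton] at hX
    exact hα₁ (by ext x; exact Subsingleton.elim _ _)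
  set E := normingSubspace (displacement A)
  obtain ⟨c, hc0, hcm, hc⟩ := exists_lt_norm_forall_orthogonal (displacement A) hm0
  rw [← hm] at hcm
  obtain ⟨β, hβ, ⟨hβε, hβE⟩, hβmin⟩ := hΓ.exists_min_norm
    (p := fun β => ‖displacement (linearPart β)‖ ≤ (m - c) / 8 ∧
      ‖β 0 - E.starProjection (β 0)‖ < ‖E.starProjection (β 0)‖)
    (hΓ.exists_displacement_le (normingSubspace_ne_bot _) (by linarith))
  set B := linearPart β with hB
  set κ := α * β * α⁻¹ * β⁻¹ with hκ
  have hκΓ : κ ∈ Γ := Γ.mul_mem (Γ.mul_mem (Γ.mul_mem hα hβ) (Γ.inv_mem hα)) (Γ.inv_mem hβ)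
  have hκB : ‖displacement (linearPart κ)‖ ≤ ‖displacement B‖ := by
    have h₁ := norm_displacement_commutator A B
    have h₂ : linearPart κ = A * B * A⁻¹ * B⁻¹ := by simp [hκ, hA, hB]
    rw [h₂]
    nlinarith [norm_nonneg (displacement B)]
  set b := β 0
  set p := E.starProjection b
  have hpE : p ∈ E := E.starProjection_apply_mem b
  have hbp : ‖b‖ < 2 * ‖p‖ := by
    have := norm_add_le p (b - p)
    rw [add_sub_cancel] at this
    linarith
  obtain ⟨r, hr, hκ0⟩ : ∃ r, ‖r‖ ≤ (m - c) / 4 * ‖b‖ ∧ κ 0 = displacement A b + r := by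
    refine ⟨κ 0 - displacement A b, ?_, by abel⟩
    have hbα : ‖displacement B‖ * ‖α 0‖ ≤ ‖displacement B‖ * ‖b‖ := by
      by_cases hB1 : B = 1
      · have : displacement B = 0 := by ext x; simp [hB1]
        simp [this]
      · gcongr
        exact hαmin β hβ ⟨hB1, by linarith⟩
    have h₁ := (displacement (linearPart κ)).le_opNorm b
    have h₂ := (displacement B).le_opNorm (A⁻¹ (α 0))
    rw [LinearIsometryEquiv.norm_map] at h₂
    have h₃ : ‖displacement (linearPart κ) b + A (displacement B (A⁻¹ (α 0)))‖ ≤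
        ‖displacement (linearPart κ) b‖ + ‖displacement B (A⁻¹ (α 0))‖ := by
      rw [← A.norm_map (displacement B (A⁻¹ (α 0)))]
      exact norm_add_le _ _
    have h₄ : κ 0 - displacement A b =
        -(displacement (linearPart κ) b + A (displacement B (A⁻¹ (α 0)))) := by
      rw [hκ, commutator_apply_zero]
      abel
    rw [h₄, norm_neg]
    nlinarith [norm_nonneg b]
  have hr' : ‖r‖ < (m - c) / 2 * ‖p‖ := by nlinarith
  have hPκ : E.starProjection (κ 0) = displacement A p + E.starProjection r := by
    rw [hκ0, map_add, starProjection_displacement]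
  have hPr : ‖E.starProjection r‖ ≤ ‖r‖ := E.norm_starProjection_apply_le r
  have hQr : ‖r - E.starProjection r‖ ≤ ‖r‖ := by
    rw [← E.starProjection_orthogonal_val]
    exact Submodule.norm_starProjection_apply_le _ _
  have hpar : m * ‖p‖ - ‖r‖ ≤ ‖E.starProjection (κ 0)‖ := by
    have h₁ : ‖displacement A p‖ = m * ‖p‖ := mem_normingSubspace.1 hpE
    have h₂ := norm_sub_le_norm_add (displacement A p) (E.starProjection r)
    rw [hPκ]
    linarith
  have hperp : ‖κ 0 - E.starProjection (κ 0)‖ ≤ c * ‖b - p‖ + ‖r‖ := by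
    have h₁ : κ 0 - E.starProjection (κ 0) =
        displacement A (b - p) + (r - E.starProjection r) := by
      rw [hPκ, hκ0, map_sub]
      abel
    have h₂ := hc _ (E.sub_starProjection_mem_orthogonal b)
    rw [h₁]
    exact (norm_add_le _ _).trans (add_le_add h₂ hQr)
  have hmin := hβmin κ hκΓ ⟨hκB.trans hβε, by nlinarith⟩
  have hup : ‖κ 0‖ ≤ m * ‖b‖ + ‖r‖ := by
    rw [hκ0]
    exact (norm_add_le _ _).trans (add_le_add_left ((displacement A).le_opNorm b) _)
  have hb0 : 0 < ‖b‖ := by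
    have h₁ : ‖p‖ ≤ ‖b‖ := E.norm_starProjection_apply_le b
    have h₂ := norm_nonneg (b - p)
    linarith
  nlinarith

/-- The first Bieberbach theorem: the point group of a space group is finite. -/
theorem finite_range_linearPart (hΓ : IsSpaceGroup Γ) :
    Finite (linearPart.comp Γ.subtype).range := by
  by_contra hinf
  rw [not_finite_iff_infinite] at hinf
  let A := Infinite.natEmbedding (linearPart.comp Γ.subtype).range
  obtain ⟨i, hi⟩ := exists_displacement_mul_inv_le
    (fun k => (A k : X ≃ₗᵢ[ℝ] X)) (one_half_pos (α := ℝ))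
  obtain ⟨j, hij, hj⟩ := hi i
  obtain ⟨γ, hγ⟩ := (A j * (A i)⁻¹).2
  have hγ' : linearPart (γ : X ≃ᵢ X) = (A j : X ≃ₗᵢ[ℝ] X) * (A i : X ≃ₗᵢ[ℝ] X)⁻¹ := hγ
  have h := hΓ.linearPart_eq_one γ.2 (hγ' ▸ hj)
  rw [hγ', mul_inv_eq_one] at h
  exact hij.ne' (A.injective (Subtype.ext h))

end IsSpaceGroup

end Bieberbach

/-- A crossed homomorphism vanishing on a subgroup of finite index is principal. -/
lemma exists_eq_sub_of_vanishes_on_finiteIndex {G X : Type*} [Group G] [AddCommGroup X]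
    [Module ℝ X] (ρ : G → X →ₗ[ℝ] X) (H : Subgroup G) [H.FiniteIndex] (C : Submodule ℝ X)
    (d : G → X) (hdC : ∀ g, d g ∈ C) (hd : ∀ g k, d (g * k) = d g + ρ g (d k))
    (hH : ∀ g ∈ H, d g = 0) : ∃ v ∈ C, ∀ g, d g = ρ g v - v := by
  have : Fintype (G ⧸ H) := H.fintypeQuotientOfFiniteIndex
  let q : G ⧸ H → X := Quotient.lift d fun a b hab => by
    replace hab := QuotientGroup.leftRel_apply.1 hab
    rw [← mul_inv_cancel_left a b, hd a, hH _ hab, map_zero, add_zero]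
  have hmul (g : G) (x : G ⧸ H) : q (g • x) = d g + ρ g (q x) := by
    induction x using QuotientGroup.induction_on with
    | H k => exact hd g k
  have hcard : (Fintype.card (G ⧸ H) : ℝ) ≠ 0 := by
    exact_mod_cast Fintype.card_ne_zero
  refine ⟨-((Fintype.card (G ⧸ H) : ℝ)⁻¹ • ∑ x, q x), C.neg_mem (C.smul_mem _
    (C.sum_mem fun x _ => ?_)), fun g => ?_⟩
  · induction x using QuotientGroup.induction_on with
    | H k => exact hdC k
  · have hsum : ∑ x, q x = (Fintype.card (G ⧸ H) : ℝ) • d g + ρ g (∑ x, q x) := by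
      conv_lhs => rw [← Equiv.sum_comp (MulAction.toPerm g) q]
      simp [hmul, Finset.sum_add_distrib, Nat.cast_smul_eq_nsmul]
    have h := congrArg ((Fintype.card (G ⧸ H) : ℝ)⁻¹ • ·) hsum
    simp only [smul_add, inv_smul_smul₀ hcard] at h
    rw [map_neg, map_smul, h]
    abel

/-- **Lemma 5**: let `N` be a complete normal subgroup of an `n`-space group `Γ`, `T` the
group of translations of `Γ`, and `𝒞 = Span(Z(N))` a `(Γ/N)`-module via `N(b+B)·v = B̄v`.
If `f : Γ/N → 𝒞` is a crossed homomorphism (given here as an `N`-invariant crossed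
homomorphism on `Γ`), then (i) its restriction to `TN/N` is a homomorphism of
`(Γ/N)`-modules, and (ii) any two crossed homomorphisms agreeing on `TN/N` differ by a
principal crossed homomorphism; so the class of `f` in `H¹(Γ/N, 𝒞)` is completely
determined by `f_res`. -/
theorem crossed_hom_determined_by_restriction {n : ℕ}
    (Γ N : Subgroup (EuclideanSpace ℝ (Fin n) ≃ᵢ EuclideanSpace ℝ (Fin n)))
    (hΓ : IsSpaceGroup Γ) (hN : IsCompleteNormal Γ N)
    (f : Γ → EuclideanSpace ℝ (Fin n))
    (hfmem : ∀ γ : Γ, f γ ∈ centerSpan N)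
    (hfN : ∀ ν γ : Γ, (ν : EuclideanSpace ℝ (Fin n) ≃ᵢ EuclideanSpace ℝ (Fin n)) ∈ N →
      f (ν * γ) = f γ)
    (hfcoc : ∀ (γ₁ γ₂ : Γ) (b₁ : EuclideanSpace ℝ (Fin n))
      (B₁ : EuclideanSpace ℝ (Fin n) ≃ₗᵢ[ℝ] EuclideanSpace ℝ (Fin n)),
      parts (γ₁ : EuclideanSpace ℝ (Fin n) ≃ᵢ EuclideanSpace ℝ (Fin n)) b₁ B₁ →
      f (γ₁ * γ₂) = f γ₁ + B₁ (f γ₂)) :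
    -- (i) `f_res` is additive and `(Γ/N)`-equivariant
    (∀ x y : Γ, (x : EuclideanSpace ℝ (Fin n) ≃ᵢ EuclideanSpace ℝ (Fin n)) ∈ TNset Γ N →
      (y : EuclideanSpace ℝ (Fin n) ≃ᵢ EuclideanSpace ℝ (Fin n)) ∈ TNset Γ N →
      f (x * y) = f x + f y) ∧
    (∀ γ x : Γ, (x : EuclideanSpace ℝ (Fin n) ≃ᵢ EuclideanSpace ℝ (Fin n)) ∈ TNset Γ N →
      ∀ (b : EuclideanSpace ℝ (Fin n))
        (B : EuclideanSpace ℝ (Fin n) ≃ₗᵢ[ℝ] EuclideanSpace ℝ (Fin n)),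
        parts (γ : EuclideanSpace ℝ (Fin n) ≃ᵢ EuclideanSpace ℝ (Fin n)) b B →
        f (γ * x * γ⁻¹) = B (f x)) ∧
    -- (ii) the class of `f` is determined by `f_res`
    (∀ h : Γ → EuclideanSpace ℝ (Fin n),
      (∀ γ : Γ, h γ ∈ centerSpan N) →
      (∀ ν γ : Γ, (ν : EuclideanSpace ℝ (Fin n) ≃ᵢ EuclideanSpace ℝ (Fin n)) ∈ N →
        h (ν * γ) = h γ) →
      (∀ (γ₁ γ₂ : Γ) (b₁ : EuclideanSpace ℝ (Fin n))
        (B₁ : EuclideanSpace ℝ (Fin n) ≃ₗᵢ[ℝ] EuclideanSpace ℝ (Fin n)),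
        parts (γ₁ : EuclideanSpace ℝ (Fin n) ≃ᵢ EuclideanSpace ℝ (Fin n)) b₁ B₁ →
        h (γ₁ * γ₂) = h γ₁ + B₁ (h γ₂)) →
      (∀ x : Γ, (x : EuclideanSpace ℝ (Fin n) ≃ᵢ EuclideanSpace ℝ (Fin n)) ∈ TNset Γ N →
        f x = h x) →
      ∃ v ∈ centerSpan N, ∀ (γ : Γ) (b : EuclideanSpace ℝ (Fin n))
        (B : EuclideanSpace ℝ (Fin n) ≃ₗᵢ[ℝ] EuclideanSpace ℝ (Fin n)),
        parts (γ : EuclideanSpace ℝ (Fin n) ≃ᵢ EuclideanSpace ℝ (Fin n)) b B →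
        f γ - h γ = B v - v) := by
  have hN' {x : EuclideanSpace ℝ (Fin n) ≃ᵢ EuclideanSpace ℝ (Fin n)} (hx : x ∈ TNset Γ N)
      {v : EuclideanSpace ℝ (Fin n)} (hv : v ∈ centerSpan N) : linearPart x v = v := by
    obtain ⟨a, ν, -, hν, rfl⟩ := hx
    simpa using linearPart_apply_of_mem_centerSpan hν hv
  have hf (γ δ : Γ) : f (γ * δ) = f γ + linearPart γ.1 (f δ) :=
    hfcoc γ δ _ _ (parts_linearPart _)
  have hf1 : f 1 = 0 := by simpa using hf 1 1
  refine ⟨fun x y hx _ => ?_, fun γ x hx b B hB => ?_, fun h hmem _ hcoc hres => ?_⟩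
  · rw [hf, hN' hx (hfmem y)]
  · have hinv := hf γ γ⁻¹
    rw [mul_inv_cancel, hf1] at hinv
    rw [hf, hf, Subgroup.coe_mul, map_mul, LinearIsometryEquiv.coe_mul, Function.comp_apply,
      hN' hx (hfmem _), add_right_comm, ← hinv, zero_add, hB.linearPart_eq]
  · have := hΓ.finite_range_linearPart
    obtain ⟨v, hv, hd⟩ := exists_eq_sub_of_vanishes_on_finiteIndex
      (fun γ : Γ => (linearPart γ.1).toLinearEquiv.toLinearMap)
      (linearPart.comp Γ.subtype).ker (centerSpan N) (fun γ => f γ - h γ)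
      (fun γ => sub_mem (hfmem γ) (hmem γ))
      (fun γ δ => by
        have hh := hcoc γ δ _ _ (parts_linearPart _)
        simp only [hf, hh, LinearEquiv.coe_coe, LinearIsometryEquiv.coe_toLinearEquiv, map_sub]
        abel)
      (fun γ hγ => by
        have heq := eq_transIso_of_linearPart_eq_one (φ := γ.1) hγ
        exact sub_eq_zero.2 (hres γ ⟨γ.1 0, 1, heq ▸ γ.2, N.one_mem, by rw [mul_one, ← heq]⟩))
    exact ⟨v, hv, fun γ b B hB => by rw [← hB.linearPart_eq]; exact hd γ⟩
end
end
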